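/- Let Q = [B | C] be an ice quiver and v a mutable vertex such that the mutable subquiver of μ_v(Q) is a fork with point of return v, and suppose μ_v(Q) satisfies: (1) every mutable vertex of μ_v(Q) is red or green; (2) if every entry of b^{[v]}_{vj}·c^{[v]}_j is ≥ 0 for some mutable j ≠ v, then sgn(c^{[v]}_j) = sgn(c^{[v]}_v) or sgn(c^{[v]}_j)·c^{[v]}_j ≥ sgn(c^{[v]}_v)·c^{[v]}_v entrywise; (3) if every entry of b^{[v]}_{vj}·c^{[v]}_j is ≤ 0 for some mutable j ≠ v, then sgn(c^{[v]}_j) = -sgn(c^{[v]}_v); (4) if every entry of b^{[v]}_{ij}·c^{[v]}_j is ≥ 0 for distinct mutable i, j both different from v, then sgn(c^{[v]}_i) = sgn(c^{[v]}_j). Let w be a reduced mutation sequence beginning with v whose last vertex is r (so r is the point of return of the mutable subquiver of μ_w(Q)). If every entry of b^w_{ir}·c^w_r is ≥ 0 for some mutable vertex i ≠ r, then sgn(c^w_i) = -sgn(c^w_r) and sgn(c^w_i)·c^w_i ≥ sgn(c^w_r)·c^w_r entrywise. -/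

import Mathlib

open Matrix

section QuiverDefs

variable {V W : Type*}

/-- Mutation of an exchange matrix at the vertex `k`. -/
def mutB [DecidableEq V] (B : Matrix V V ℤ) (k : V) : Matrix V V ℤ :=
  Matrix.of fun i j =>
    if i = k ∨ j = k then -B i j else B i j + (B i k).sign * max (B i k * B k j) 0

/-- Mutation of the `C`-matrix of an extended exchange matrix `[B | C]` at the vertex `k`. -/
def mutC [DecidableEq V] (B : Matrix V V ℤ) (C : Matrix V W ℤ) (k : V) : Matrix V W ℤ :=
  Matrix.of fun i j =>
    if i = k then -C i j else C i j + (B i k).sign * max (B i k * C k j) 0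

/-- One mutation step on an extended exchange matrix `[B | C]`, regarded as a pair `(B, C)`. -/
def mutPair [DecidableEq V] (P : Matrix V V ℤ × Matrix V W ℤ) (k : V) :
    Matrix V V ℤ × Matrix V W ℤ :=
  (mutB P.1 k, mutC P.1 P.2 k)

/-- Iterated mutation of an extended exchange matrix along a list of mutable vertices. -/
def mutSeqPair [DecidableEq V] (P : Matrix V V ℤ × Matrix V W ℤ) (w : List V) :
    Matrix V V ℤ × Matrix V W ℤ :=
  w.foldl mutPair P

/-- Iterated mutation of an exchange matrix along a list of vertices. -/
def mutSeqB [DecidableEq V] (B : Matrix V V ℤ) (w : List V) : Matrix V V ℤ :=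
  w.foldl mutB B

/-- A quiver is abundant if there are at least two arrows between any two distinct vertices. -/
def QAbundant (B : Matrix V V ℤ) : Prop := ∀ i j, i ≠ j → 2 ≤ |B i j|

/-- There is a directed cycle of the quiver `B` all of whose vertices lie in `S`. -/
def HasCycleIn (B : Matrix V V ℤ) (S : Set V) : Prop :=
  ∃ (x : V) (l : List V), x ∈ S ∧ (∀ y ∈ l, y ∈ S) ∧
    List.Chain (fun i j => 0 < B i j) x (l ++ [x])

/-- A quiver is acyclic if it has no directed cycle. -/
def QAcyclic (B : Matrix V V ℤ) : Prop := ¬ HasCycleIn B Set.univ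

/-- The vertex `x` is a source: all arrows at `x` point away from `x`. -/
def QSource (B : Matrix V V ℤ) (x : V) : Prop := ∀ j, 0 ≤ B x j

/-- The vertex `x` is a sink: all arrows at `x` point into `x`. -/
def QSink (B : Matrix V V ℤ) (x : V) : Prop := ∀ j, B x j ≤ 0

/-- `B` is a fork with point of return `r`: it is abundant, not acyclic, the full subquiver
obtained by deleting `r` is acyclic, and for all `i` with `i → r` and `j` with `r → j` one has
`b_{ji} > b_{ir}` and `b_{ji} > b_{rj}`. -/
def QFork (B : Matrix V V ℤ) (r : V) : Prop :=
  QAbundant B ∧ ¬ QAcyclic B ∧ ¬ HasCycleIn B {x | x ≠ r} ∧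
    ∀ i j, 0 < B i r → 0 < B r j → B i r < B j i ∧ B r j < B j i

/-- The mutable vertex `i` is green: its `c`-vector is nonzero with all entries `≥ 0`. -/
def QGreen (C : Matrix V W ℤ) (i : V) : Prop := (∀ j, 0 ≤ C i j) ∧ C i ≠ 0

/-- The mutable vertex `i` is red: its `c`-vector is nonzero with all entries `≤ 0`. -/
def QRed (C : Matrix V W ℤ) (i : V) : Prop := (∀ j, C i j ≤ 0) ∧ C i ≠ 0

/-- The mutable vertex `i` is blue: its `c`-vector is zero. -/
def QBlue (C : Matrix V W ℤ) (i : V) : Prop := C i = 0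

/-- `i` has the same color (red/green/blue) with respect to `C` and to `C'`. -/
def SameColorQ (C C' : Matrix V W ℤ) (i : V) : Prop :=
  (QRed C i ↔ QRed C' i) ∧ (QGreen C i ↔ QGreen C' i) ∧ (QBlue C i ↔ QBlue C' i)

/-- The `c`-vectors of `i` and `j` have the same sign (`sgn(c_i) = sgn(c_j)`). -/
def SameSignQ (C : Matrix V W ℤ) (i j : V) : Prop :=
  (QGreen C i ∧ QGreen C j) ∨ (QRed C i ∧ QRed C j)

/-- The `c`-vectors of `i` and `j` have opposite signs (`sgn(c_i) = -sgn(c_j)`). -/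
def OppSignQ (C : Matrix V W ℤ) (i j : V) : Prop :=
  (QGreen C i ∧ QRed C j) ∨ (QRed C i ∧ QGreen C j)

/-- An ice quiver is uniformly sign-coherent if after every mutation sequence every mutable
vertex is red, green, or blue, and not every mutable vertex of the initial quiver is blue. -/
def USC [DecidableEq V] (P : Matrix V V ℤ × Matrix V W ℤ) : Prop :=
  (∀ (w : List V) (i : V),
      QRed (mutSeqPair P w).2 i ∨ QGreen (mutSeqPair P w).2 i ∨ QBlue (mutSeqPair P w).2 i) ∧
    ¬ ∀ i, QBlue P.2 i

/-- An ice quiver is strictly sign-coherent if after every mutation sequence every mutable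
vertex is red or green. -/
def SSC [DecidableEq V] (P : Matrix V V ℤ × Matrix V W ℤ) : Prop :=
  ∀ (w : List V) (i : V), QRed (mutSeqPair P w).2 i ∨ QGreen (mutSeqPair P w).2 i

/-- The four sign conditions at the distinguished vertex `r`:
(1) every mutable vertex is red or green;
(2) if every entry of `b_{rj}·c_j` is `≥ 0` for some `j ≠ r`, then `sgn(c_j) = sgn(c_r)` or
    `sgn(c_j)·c_j ≥ sgn(c_r)·c_r` entrywise (i.e. `|c_r| ≤ |c_j|` entrywise);
(3) if every entry of `b_{rj}·c_j` is `≤ 0` for some `j ≠ r`, then `sgn(c_j) = -sgn(c_r)`;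
(4) if every entry of `b_{ij}·c_j` is `≥ 0` for distinct `i, j` both `≠ r`,
    then `sgn(c_i) = sgn(c_j)`. -/
def FourConds (Bw : Matrix V V ℤ) (Cw : Matrix V W ℤ) (r : V) : Prop :=
  (∀ i, QRed Cw i ∨ QGreen Cw i) ∧
  (∀ j, j ≠ r → (∀ t, 0 ≤ Bw r j * Cw j t) →
    (SameSignQ Cw j r ∨ ∀ t, |Cw r t| ≤ |Cw j t|)) ∧
  (∀ j, j ≠ r → (∀ t, Bw r j * Cw j t ≤ 0) → OppSignQ Cw j r) ∧
  (∀ i j, i ≠ j → i ≠ r → j ≠ r → (∀ t, 0 ≤ Bw i j * Cw j t) → SameSignQ Cw i j)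

end QuiverDefs

section Helpers

variable {V W : Type*} [DecidableEq V]

/-- The fork data used in the induction. -/
structure WFork (B : Matrix V V ℤ) (r : V) : Prop where
  skew : ∀ i j, B j i = -B i j
  ab : ∀ i j, i ≠ j → 2 ≤ B i j ∨ 2 ≤ B j i
  tr : ∀ i j l, i ≠ r → j ≠ r → l ≠ r → 0 < B i j → 0 < B j l → 0 < B i l
  fk : ∀ i j, 0 < B i r → 0 < B r j → B i r < B j i ∧ B r j < B j i

/-- The sign data used in the induction. -/
structure SInv (B : Matrix V V ℤ) (C : Matrix V W ℤ) (s : V → ℤ) (r : V) : Prop where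
  pm : ∀ i, s i = 1 ∨ s i = -1
  nn : ∀ i t, 0 ≤ s i * C i t
  nz : ∀ i, ∃ t, C i t ≠ 0
  big : ∀ j, j ≠ r → s j = - s r → 0 < B r j * s j → ∀ t, s r * C r t ≤ s j * C j t
  same : ∀ j, j ≠ r → s j = s r → 0 < B r j * s j
  ord : ∀ i j, i ≠ r → j ≠ r → s i = 1 → s j = -1 → 0 < B i j

theorem mutB_left (B : Matrix V V ℤ) (k j : V) : mutB B k k j = -B k j := by simp [mutB]

theorem mutB_right (B : Matrix V V ℤ) (k j : V) : mutB B k j k = -B j k := by simp [mutB]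

theorem mutB_pp (B : Matrix V V ℤ) {i j k : V} (hi : i ≠ k) (hj : j ≠ k)
    (h1 : 0 < B i k) (h2 : 0 < B k j) : mutB B k i j = B i j + B i k * B k j := by
  simp [mutB, hi, hj, Int.sign_eq_one_of_pos h1, max_eq_left (mul_pos h1 h2).le]

theorem mutB_nn (B : Matrix V V ℤ) {i j k : V} (hi : i ≠ k) (hj : j ≠ k)
    (h1 : B i k < 0) (h2 : B k j < 0) : mutB B k i j = B i j - B i k * B k j := by
  simp [mutB, hi, hj, Int.sign_eq_neg_one_of_neg h1, max_eq_left (mul_pos_of_neg_of_neg h1 h2).le]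
  ring

theorem mutB_zero (B : Matrix V V ℤ) {i j k : V} (hi : i ≠ k) (hj : j ≠ k)
    (h : B i k * B k j ≤ 0) : mutB B k i j = B i j := by
  simp [mutB, hi, hj, max_eq_right h]

theorem mutC_self (B : Matrix V V ℤ) (C : Matrix V W ℤ) (k : V) (t : W) :
    mutC B C k k t = -C k t := by simp [mutC]

theorem mutC_pos (B : Matrix V V ℤ) (C : Matrix V W ℤ) {i k : V} (t : W) (hi : i ≠ k)
    (h : 0 < B i k) (hc : 0 ≤ C k t) : mutC B C k i t = C i t + B i k * C k t := by
  simp [mutC, hi, Int.sign_eq_one_of_pos h, max_eq_left (mul_nonneg h.le hc)]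

theorem mutC_neg (B : Matrix V V ℤ) (C : Matrix V W ℤ) {i k : V} (t : W) (hi : i ≠ k)
    (h : B i k < 0) (hc : C k t ≤ 0) : mutC B C k i t = C i t - B i k * C k t := by
  simp [mutC, hi, Int.sign_eq_neg_one_of_neg h,
    max_eq_left (mul_nonneg_of_nonpos_of_nonpos h.le hc)]
  ring

theorem mutC_zero (B : Matrix V V ℤ) (C : Matrix V W ℤ) {i k : V} (t : W) (hi : i ≠ k)
    (h : B i k * C k t ≤ 0) : mutC B C k i t = C i t := by
  simp [mutC, hi, max_eq_right h]

theorem mutB_skew (B : Matrix V V ℤ) (k : V) (hs : ∀ i j, B j i = -B i j) (i j : V) :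
    mutB B k j i = - mutB B k i j := by
  by_cases hi : i = k
  · subst hi; rw [mutB_left, mutB_right, hs i j]
  by_cases hj : j = k
  · subst hj; rw [mutB_left, mutB_right, hs i j]
  rcases le_or_gt (B i k * B k j) 0 with h | h
  · rw [mutB_zero B hi hj h, mutB_zero B hj hi (by rw [hs k j, hs i k]; linarith), hs i j]
  · rcases pos_and_pos_or_neg_and_neg_of_mul_pos h with ⟨a, b⟩ | ⟨a, b⟩
    · rw [mutB_pp B hi hj a b, mutB_nn B hj hi (by rw [hs k j]; linarith)
        (by rw [hs i k]; linarith), hs i j, hs k j, hs i k]; ring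
    · rw [mutB_nn B hi hj a b, mutB_pp B hj hi (by rw [hs k j]; linarith)
        (by rw [hs i k]; linarith), hs i j, hs k j, hs i k]; ring

theorem WFork.pos {B : Matrix V V ℤ} {r : V} (h : WFork B r) {i j : V} (hij : i ≠ j) :
    (2 ≤ B i j ∧ B j i ≤ -2) ∨ (2 ≤ B j i ∧ B i j ≤ -2) := by
  have := h.ab i j hij
  have := h.skew i j
  omega

/-- Arrows away from `r` and `k` keep direction and do not lose weight. -/
theorem WFork.keep {B : Matrix V V ℤ} {r k : V} (h : WFork B r) (hk : k ≠ r) {i j : V}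
    (hi : i ≠ r) (hj : j ≠ r) (hik : i ≠ k) (hjk : j ≠ k) (hp : 0 < B i j) :
    B i j ≤ mutB B k i j := by
  rcases h.pos hik with ⟨a, a'⟩ | ⟨a, a'⟩ <;> rcases h.pos hjk with ⟨b, b'⟩ | ⟨b, b'⟩
  · rw [mutB_zero B hik hjk (by nlinarith)]
  · rw [mutB_pp B hik hjk (by omega) (by omega)]; nlinarith
  · have := h.tr j k i hj hk hi (by omega) (by omega)
    have := h.skew i j
    omega
  · rw [mutB_zero B hik hjk (by nlinarith)]

theorem WFork.src {B : Matrix V V ℤ} {r k : V} (h : WFork B r) (hk : k ≠ r)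
    (hrk : 0 < B r k) {j : V} (hj : j ≠ r) (hjk : j ≠ k) :
    2 ≤ mutB B k r j ∧ (0 < B k j → B r k < mutB B k r j ∧ B k j < mutB B k r j) := by
  have a : 2 ≤ B r k := by rcases h.pos hk with h | h <;> omega
  rcases h.pos hjk with ⟨b, b'⟩ | ⟨b, b'⟩
  · rw [mutB_zero B hk.symm hjk (by nlinarith)]
    rcases h.pos hj with ⟨c, c'⟩ | ⟨c, c'⟩
    · have := h.fk j k (by omega) hrk
      omega
    · exact ⟨c, by omega⟩
  · rw [mutB_pp B hk.symm hjk (by omega) (by omega)]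
    rcases h.pos hj with ⟨c, c'⟩ | ⟨c, c'⟩
    · have := h.fk j k (by omega) hrk
      have := h.skew j r
      refine ⟨by nlinarith, fun _ => ⟨by nlinarith, by nlinarith⟩⟩
    · refine ⟨by nlinarith, fun _ => ⟨by nlinarith, by nlinarith⟩⟩

theorem mutB_negate (B : Matrix V V ℤ) (k : V) : mutB (-B) k = - mutB B k := by
  ext i j
  by_cases h : i = k ∨ j = k
  · simp [mutB, h]
  · simp [mutB, h]; ring

theorem mutC_negate (B : Matrix V V ℤ) (C : Matrix V W ℤ) (k : V) :
    mutC (-B) (-C) k = - mutC B C k := by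
  ext i j
  by_cases h : i = k
  · simp [mutC, h]
  · simp [mutC, h]; ring

theorem WFork.negate {B : Matrix V V ℤ} {r : V} (h : WFork B r) : WFork (-B) r where
  skew i j := by simp [h.skew i j]
  ab i j hij := by
    rcases h.pos hij with h | h <;> simp only [Matrix.neg_apply] <;> omega
  tr i j l hi hj hl h1 h2 := by
    simp only [Matrix.neg_apply] at *
    have := h.tr l j i hl hj hi (by have := h.skew j l; omega) (by have := h.skew i j; omega)
    have := h.skew i l
    omega
  fk i j h1 h2 := by
    simp only [Matrix.neg_apply] at *
    have := h.fk j i (by have := h.skew r j; omega) (by have := h.skew i r; omega)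
    have := h.skew r j
    have := h.skew i r
    have := h.skew i j
    omega

theorem WFork.snk {B : Matrix V V ℤ} {r k : V} (h : WFork B r) (hk : k ≠ r)
    (hrk : 0 < B k r) {j : V} (hj : j ≠ r) (hjk : j ≠ k) :
    2 ≤ mutB B k j r ∧ (0 < B j k → B k r < mutB B k j r ∧ B j k < mutB B k j r) := by
  have := h.negate.src hk (by simp [h.skew k r, hrk]) hj hjk
  rw [mutB_negate] at this
  simp only [Matrix.neg_apply] at this
  rw [← mutB_skew B k h.skew, ← h.skew, ← h.skew] at this
  exact this

theorem WFork.step {B : Matrix V V ℤ} {r k : V} (h : WFork B r) (hk : k ≠ r) :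
    WFork (mutB B k) k where
  skew := mutB_skew B k h.skew
  ab i j hij := by
    have hsk := mutB_skew B k h.skew i j
    have main : ∀ i j, i ≠ j → i ≠ k → j ≠ k → 2 ≤ mutB B k i j ∨ 2 ≤ mutB B k j i := by
      intro i j hij hik hjk
      by_cases hir : i = r
      · subst hir
        rcases h.pos hk with ⟨a, _⟩ | ⟨a, _⟩
        · exact Or.inr (h.snk hk (by omega) hij.symm hjk).1
        · exact Or.inl (h.src hk (by omega) hij.symm hjk).1
      by_cases hjr : j = r
      · subst hjr
        rcases h.pos hk with ⟨a, _⟩ | ⟨a, _⟩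
        · exact Or.inl (h.snk hk (by omega) hij hik).1
        · exact Or.inr (h.src hk (by omega) hij hik).1
      rcases h.pos hij with ⟨a, _⟩ | ⟨a, _⟩
      · have := h.keep hk hir hjr hik hjk (by omega)
        omega
      · have := h.keep hk hjr hir hjk hik (by omega)
        omega
    by_cases hi : i = k
    · subst hi; rw [mutB_left, mutB_right]; rcases h.pos hij with h | h <;> omega
    by_cases hj : j = k
    · subst hj; rw [mutB_left, mutB_right]; rcases h.pos hij with h | h <;> omega
    exact main i j hij hi hj
  tr i j l hi hj hl h1 h2 := by
    have sk := mutB_skew B k h.skew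
    have irr : ∀ x, ¬ 0 < mutB B k x x := fun x => by have := sk x x; omega
    have back : ∀ i j, i ≠ k → j ≠ k → i ≠ r → j ≠ r → 0 < mutB B k i j → 0 < B i j := by
      intro i j hi hj hir hjr hp
      by_cases e : i = j
      · subst e; exact absurd hp (irr i)
      rcases h.pos e with ⟨a, _⟩ | ⟨a, _⟩
      · omega
      · have := h.keep hk hjr hir hj hi (by omega)
        have := sk i j
        omega
    have s1 := sk i j
    have s2 := sk j l
    rcases h.pos hk with ⟨a, _⟩ | ⟨a, _⟩
    · have S := fun {j} => h.snk hk (by omega) (j := j)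
      have hjr : j ≠ r := by
        rintro rfl
        by_cases e : l = j
        · subst e; exact irr _ h2
        · have := (S e hl).1; omega
      have hir : i ≠ r := by
        rintro rfl
        have := (S hjr hj).1; omega
      by_cases hlr : l = r
      · subst hlr; have := (S hir hi).1; omega
      have p := h.tr i j l hir hjr hlr (back _ _ hi hj hir hjr h1) (back _ _ hj hl hjr hlr h2)
      have := h.keep hk hir hlr hi hl p
      omega
    · have S := fun {j} => h.src hk (by omega) (j := j)
      have hjr : j ≠ r := by
        rintro rfl
        by_cases e : i = j
        · subst e; exact irr _ h1
        · have := (S e hi).1; omega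
      have hlr : l ≠ r := by
        rintro rfl
        have := (S hjr hj).1; omega
      by_cases hir : i = r
      · subst hir; have := (S hlr hl).1; omega
      have p := h.tr i j l hir hjr hlr (back _ _ hi hj hir hjr h1) (back _ _ hj hl hjr hlr h2)
      have := h.keep hk hir hlr hi hl p
      omega
  fk i j h1 h2 := by
    rw [mutB_right] at h1 ⊢
    rw [mutB_left] at h2 ⊢
    have e1 := h.skew i k
    have e2 := h.skew k j
    have e3 := h.skew k k
    have hi : i ≠ k := by rintro rfl; omega
    have hj : j ≠ k := by rintro rfl; omega
    by_cases hir : i = r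
    · subst hir
      by_cases hjr : j = i
      · subst hjr; omega
      have := (h.snk hk (by omega) hjr hj).2 (by omega)
      omega
    by_cases hjr : j = r
    · subst hjr
      have := (h.src hk (by omega) hir hi).2 (by omega)
      omega
    have p := h.tr j k i hjr hk hir (by omega) (by omega)
    rw [mutB_pp B hj hi (by omega) (by omega)]
    have q1 : 2 ≤ B j k := by rcases h.pos hj with h | h <;> omega
    have q2 : 2 ≤ B k i := by rcases h.pos hi with h | h <;> omega
    constructor <;> nlinarith

theorem SInv.negate {B : Matrix V V ℤ} {C : Matrix V W ℤ} {s : V → ℤ} {r : V}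
    (hB : ∀ i j, B j i = -B i j)
    (h : SInv B C s r) : SInv (-B) (-C) (-s) r where
  pm i := by have := h.pm i; simp only [Pi.neg_apply]; omega
  nn i t := by simpa using h.nn i t
  nz i := by simpa using h.nz i
  big j hj h1 h2 t := by
    have := h.big j hj (by simp only [Pi.neg_apply] at h1; omega) (by simpa using h2) t
    simpa using this
  same j hj h1 := by
    have := h.same j hj (by simpa using h1)
    simpa using this
  ord i j hi hj h1 h2 := by
    have := h.ord j i hj hi (by simpa using h2) (by simp at h1; omega)
    have := hB i j
    simp only [Matrix.neg_apply]; omega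

theorem SInv.step_pos {B : Matrix V V ℤ} {C : Matrix V W ℤ} {s : V → ℤ} {r k : V}
    (hf : WFork B r) (h : SInv B C s r) (hk : k ≠ r) (hr : s r = 1) :
    ∃ s', SInv (mutB B k) (mutC B C k) s' k := by
  have sk := mutB_skew B k hf.skew
  have two : ∀ {i j}, 0 < B i j → 2 ≤ B i j := by
    intro i j hp
    have hij : i ≠ j := by rintro rfl; have := hf.skew i i; omega
    rcases hf.pos hij with h | h <;> omega
  -- green vertices receive arrows from `r`
  have green : ∀ j, j ≠ r → s j = 1 → 0 < B r j := by
    intro j hj hs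
    have := h.same j hj (by omega)
    rw [hs] at this; omega
  have nnG : ∀ i, s i = 1 → ∀ t, 0 ≤ C i t := by
    intro i hi t; have := h.nn i t; rw [hi] at this; omega
  have npR : ∀ i, s i = -1 → ∀ t, C i t ≤ 0 := by
    intro i hi t; have := h.nn i t; rw [hi] at this; omega
  have nzN : ∀ {i : V} {x : W → ℤ}, (∀ t, |C i t| ≤ |x t|) → ∃ t, x t ≠ 0 := by
    intro i x hx
    obtain ⟨t, ht⟩ := h.nz i
    refine ⟨t, fun h0 => ?_⟩
    have := hx t
    rw [h0, abs_zero] at this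
    exact ht (abs_nonpos_iff.mp this)
  -- arrows between greens and reds away from `r`
  have ordk : ∀ i j, i ≠ r → j ≠ r → i ≠ k → j ≠ k → s i = 1 → s j = -1 →
      0 < mutB B k i j := by
    intro i j hi hj hik hjk h1 h2
    have p := h.ord i j hi hj h1 h2
    have := hf.keep hk hi hj hik hjk p
    omega
  rcases h.pm k with hsk | hsk
  · -- `k` is green
    have hrk := green k hk hsk
    have cg := nnG k hsk
    have up : ∀ i t, i ≠ k → 0 < B i k → mutC B C k i t = C i t + B i k * C k t :=
      fun i t hi hp => mutC_pos B C t hi hp (cg t)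
    have st : ∀ i t, i ≠ k → B i k ≤ 0 → mutC B C k i t = C i t :=
      fun i t hi hp => mutC_zero B C t hi (mul_nonpos_of_nonpos_of_nonneg hp (cg t))
    have red : ∀ i, i ≠ k → s i = -1 → 0 < B k i ∧ B i k < 0 := by
      intro i hi hs
      have hir : i ≠ r := by rintro rfl; omega
      have := h.ord k i hk hir hsk hs
      have := hf.skew k i
      omega
    refine ⟨fun i => if i = k then -1 else s i, ?_, ?_, ?_, ?_, ?_, ?_⟩
    · intro i
      by_cases hi : i = k
      · simp [hi]
      · simpa [hi] using h.pm i
    · intro i t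
      by_cases hi : i = k
      · subst hi; simpa [mutC_self] using cg t
      simp only [hi, if_false]
      rcases lt_or_ge 0 (B i k) with hp | hp
      · rw [up i t hi hp]
        rcases h.pm i with hs | hs
        · have := nnG i hs t
          have := mul_nonneg hp.le (cg t)
          rw [hs]; omega
        · have := red i hi hs
          omega
      · rw [st i t hi hp]; exact h.nn i t
    · intro i
      by_cases hi : i = k
      · subst hi
        obtain ⟨t, ht⟩ := h.nz i
        exact ⟨t, by rw [mutC_self]; omega⟩
      rcases lt_or_ge 0 (B i k) with hp | hp
      · have hs : s i = 1 := by
          rcases h.pm i with hs | hs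
          · exact hs
          · have := red i hi hs; omega
        apply nzN (i := i)
        intro t
        have := nnG i hs t
        have := mul_nonneg hp.le (cg t)
        rw [up i t hi hp, abs_of_nonneg, abs_of_nonneg] <;> omega
      · obtain ⟨t, ht⟩ := h.nz i
        exact ⟨t, by rw [st i t hi hp]; exact ht⟩
    · intro i hi h1 h2 t
      simp only [hi, if_false, if_true] at h1 h2 ⊢
      have hs : s i = 1 := by omega
      rw [mutB_left, hs] at h2
      have := hf.skew k i
      have hp : 0 < B i k := by omega
      rw [mutC_self, up i t hi hp, hs]
      have := nnG i hs t
      have := cg t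
      nlinarith
    · intro i hi h1
      simp only [hi, if_false, if_true] at h1 ⊢
      rw [mutB_left, h1]
      have := red i hi h1
      omega
    · intro i j hi hj h1 h2
      simp only [hi, hj, if_false] at h1 h2
      have hjr : j ≠ r := by rintro rfl; omega
      by_cases hir : i = r
      · subst hir
        have := (hf.src hk hrk hjr hj).1
        omega
      exact ordk i j hir hjr hi hj h1 h2
  · -- `k` is red
    have cr := npR k hsk
    have up : ∀ i t, i ≠ k → B i k < 0 → mutC B C k i t = C i t - B i k * C k t :=
      fun i t hi hp => mutC_neg B C t hi hp (cr t)
    have st : ∀ i t, i ≠ k → 0 ≤ B i k → mutC B C k i t = C i t :=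
      fun i t hi hp => mutC_zero B C t hi (mul_nonpos_of_nonneg_of_nonpos hp (cr t))
    have grn : ∀ i, i ≠ k → i ≠ r → s i = 1 → 0 < B i k := by
      intro i hi hir hs
      exact h.ord i k hir hk hs hsk
    -- vertices below `k` become very red
    have low : ∀ i t, i ≠ k → B i k < 0 → mutC B C k i t ≤ C k t := by
      intro i t hi hp
      rw [up i t hi hp]
      have e := hf.skew k i
      have := two (i := k) (j := i) (by omega)
      have := cr t
      by_cases hir : i = r
      · subst hir
        have := h.big k hk (by omega) (by rw [hsk]; omega) t
        rw [hsk, hr] at this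
        nlinarith
      · have hs : s i = -1 := by
          rcases h.pm i with hs | hs
          · have := grn i hi hir hs; omega
          · exact hs
        have := npR i hs t
        nlinarith
    have flip : ∀ i, i ≠ k → B i k < 0 →
        (if i = k then (1 : ℤ) else if i = r ∧ B i k < 0 then -1 else s i) = -1 := by
      intro i hi hp
      by_cases hir : i = r
      · rw [if_neg hi, if_pos ⟨hir, hp⟩]
      · simp only [hi, hir, if_false, false_and]
        rcases h.pm i with hs | hs
        · have := grn i hi hir hs; omega
        · exact hs
    have keep : ∀ i, i ≠ k → 0 ≤ B i k →
        (if i = k then (1 : ℤ) else if i = r ∧ B i k < 0 then -1 else s i) = s i := by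
      intro i hi hp
      have : ¬ (i = r ∧ B i k < 0) := by omega
      simp [hi, this]
    refine ⟨fun i => if i = k then 1 else if i = r ∧ B i k < 0 then -1 else s i,
      ?_, ?_, ?_, ?_, ?_, ?_⟩
    · intro i
      have := h.pm i
      split_ifs <;> omega
    · intro i t
      by_cases hi : i = k
      · subst hi; simpa [mutC_self] using cr t
      rcases lt_or_ge (B i k) 0 with hp | hp
      · rw [flip i hi hp]
        have := low i t hi hp
        have := cr t
        omega
      · rw [keep i hi hp, st i t hi hp]; exact h.nn i t
    · intro i
      by_cases hi : i = k
      · subst hi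
        obtain ⟨t, ht⟩ := h.nz i
        exact ⟨t, by rw [mutC_self]; omega⟩
      rcases lt_or_ge (B i k) 0 with hp | hp
      · apply nzN (i := k)
        intro t
        have := low i t hi hp
        have := cr t
        rw [abs_of_nonpos, abs_of_nonpos] <;> omega
      · obtain ⟨t, ht⟩ := h.nz i
        exact ⟨t, by rw [st i t hi hp]; exact ht⟩
    · intro i hi h1 h2 t
      rw [if_pos rfl] at h1 ⊢
      rw [h1] at h2 ⊢
      rw [mutB_left] at h2
      have := hf.skew k i
      have := low i t hi (by omega)
      rw [mutC_self]
      omega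
    · intro i hi h1
      rw [if_pos rfl] at h1
      rw [h1, mutB_left]
      have := hf.skew k i
      rcases hf.pos hi with ⟨a, _⟩ | ⟨a, _⟩
      · omega
      · have := flip i hi (by omega)
        omega
    · intro i j hi hj h1 h2
      have hip : 0 < B i k := by
        rcases hf.pos hi with ⟨a, _⟩ | ⟨a, _⟩
        · omega
        · have := flip i hi (by omega)
          omega
      rw [keep i hi hip.le] at h1
      by_cases hir : i = r
      · subst hir
        have hjr : j ≠ i := by
          rintro rfl
          rw [keep j hi hip.le] at h2
          omega
        have := (hf.src hk hip hjr hj).1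
        omega
      by_cases hjr : j = r
      · subst hjr
        have hjp : 0 < B k j := by
          rcases hf.pos hj with ⟨a, _⟩ | ⟨a, _⟩
          · rw [keep j hj (by omega)] at h2
            omega
          · omega
        have := (hf.snk hk hjp hir hi).1
        omega
      have : s j = -1 := by
        simpa [hj, hjr] using h2
      exact ordk i j hir hjr hi hj h1 this

theorem SInv.step {B : Matrix V V ℤ} {C : Matrix V W ℤ} {s : V → ℤ} {r k : V}
    (hf : WFork B r) (h : SInv B C s r) (hk : k ≠ r) :
    ∃ s', SInv (mutB B k) (mutC B C k) s' k := by
  rcases h.pm r with hr | hr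
  · exact h.step_pos hf hk hr
  · obtain ⟨s', hs'⟩ := (h.negate hf.skew).step_pos hf.negate hk (by simp [hr])
    rw [mutB_negate, mutC_negate] at hs'
    have := hs'.negate (fun i j => by simp [mutB_skew B k hf.skew i j])
    rw [neg_neg, neg_neg] at this
    exact ⟨_, this⟩

theorem inv_fold (u : List V) : ∀ (r : V) (P : Matrix V V ℤ × Matrix V W ℤ) (s : V → ℤ),
    WFork P.1 r → SInv P.1 P.2 s r → List.IsChain (· ≠ ·) (r :: u) →
    WFork (u.foldl mutPair P).1 ((r :: u).getLast (by simp)) ∧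
    ∃ s', SInv (u.foldl mutPair P).1 (u.foldl mutPair P).2 s' ((r :: u).getLast (by simp)) := by
  induction u with
  | nil => intro r P s h1 h2 _; exact ⟨h1, s, h2⟩
  | cons k u ih =>
    intro r P s h1 h2 hc
    rw [List.isChain_cons_cons] at hc
    obtain ⟨s', hs'⟩ := h2.step h1 (Ne.symm hc.1)
    have := ih k (mutPair P k) s' (h1.step (Ne.symm hc.1)) hs' hc.2
    simpa using this

theorem wfork_of_fork {B : Matrix V V ℤ} {r : V} (hs : ∀ i j, B j i = -B i j)
    (h : QFork B r) : WFork B r where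
  skew := hs
  ab i j hij := by
    have := h.1 i j hij
    have := hs i j
    rcases abs_cases (B i j) with h | h <;> omega
  tr i j l hi hj hl h1 h2 := by
    by_contra hcon
    have hil : i ≠ l := by
      rintro rfl; have := hs i j; omega
    have := h.1 i l hil
    have := hs i l
    have hli : 0 < B l i := by rcases abs_cases (B i l) with h | h <;> omega
    refine h.2.2.1 ⟨i, [j, l], hi, ?_, ?_⟩
    · intro y hy
      simp at hy
      rcases hy with rfl | rfl <;> assumption
    · show List.IsChain _ _
      simp [h1, h2, hli]
  fk := h.2.2.2

theorem nz_of_ne {C : Matrix V W ℤ} {i : V} (h : C i ≠ 0) : ∃ t, C i t ≠ 0 := by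
  by_contra hc
  push Not at hc
  exact h (funext hc)

theorem sinv_of_four {B : Matrix V V ℤ} {C : Matrix V W ℤ} {r : V} (hf : WFork B r)
    (h : FourConds B C r) : ∃ s, SInv B C s r := by
  obtain ⟨h1, h2, h3, h4⟩ := h
  have excl : ∀ i, QRed C i → QGreen C i → False := by
    intro i a b
    exact a.2 (funext fun t => le_antisymm (a.1 t) (b.1 t))
  classical
  let s : V → ℤ := fun i => if QGreen C i then 1 else -1
  have pm : ∀ i, (s i = 1 ∧ QGreen C i) ∨ (s i = -1 ∧ QRed C i) := by
    intro i
    by_cases hg : QGreen C i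
    · left; simp [s, hg]
    · right; exact ⟨by simp [s, hg], (h1 i).resolve_right hg⟩
  have nn : ∀ i t, 0 ≤ s i * C i t := by
    intro i t
    rcases pm i with ⟨a, b⟩ | ⟨a, b⟩ <;> have := b.1 t <;> rw [a] <;> omega
  have ss : ∀ i, s i * s i = 1 := by
    intro i
    rcases pm i with ⟨a, b⟩ | ⟨a, b⟩ <;> rw [a] <;> rfl
  have hab : ∀ i t, |C i t| = s i * C i t := by
    intro i t
    rcases pm i with ⟨a, b⟩ | ⟨a, b⟩ <;> have := b.1 t <;> rw [a]
    · rw [abs_of_nonneg this]; ring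
    · rw [abs_of_nonpos this]; ring
  have same : ∀ i j, SameSignQ C i j → s i = s j := by
    intro i j h
    rcases pm i with ⟨a, b⟩ | ⟨a, b⟩ <;> rcases pm j with ⟨c, d⟩ | ⟨c, d⟩ <;>
      rcases h with ⟨e, f⟩ | ⟨e, f⟩ <;> first
      | (rw [a, c]; done)
      | exact absurd (excl i ‹_› ‹_›) id
      | exact absurd (excl j ‹_› ‹_›) id
  have opp : ∀ i j, OppSignQ C i j → s i = - s j := by
    intro i j h
    rcases pm i with ⟨a, b⟩ | ⟨a, b⟩ <;> rcases pm j with ⟨c, d⟩ | ⟨c, d⟩ <;>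
      rcases h with ⟨e, f⟩ | ⟨e, f⟩ <;> first
      | (rw [a, c]; done)
      | (rw [a, c]; rfl)
      | exact absurd (excl i ‹_› ‹_›) id
      | exact absurd (excl j ‹_› ‹_›) id
  have prod : ∀ (i j : V) (t : W), B i j * C j t = (B i j * s j) * (s j * C j t) := by
    intro i j t
    linear_combination (-B i j * C j t) * ss j
  have ne : ∀ i j, i ≠ j → B i j * s j ≠ 0 := by
    intro i j hij
    apply mul_ne_zero
    · rcases hf.pos hij with h | h <;> omega
    · intro h0; have := ss j; rw [h0] at this; omega
  refine ⟨s, ?_, nn, ?_, ?_, ?_, ?_⟩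
  · intro i; rcases pm i with h | h <;> simp [h.1]
  · intro i
    rcases pm i with ⟨_, h⟩ | ⟨_, h⟩ <;> exact nz_of_ne h.2
  · intro j hj e p t
    rcases h2 j hj (fun t => by rw [prod]; exact mul_nonneg p.le (nn j t)) with h | h
    · have := same _ _ h
      have := ss r
      have : s r = 0 := by omega
      simp [this] at *
    · rw [← hab, ← hab]; exact h t
  · intro j hj e
    by_contra hc
    have := opp _ _ (h3 j hj (fun t => by
      rw [prod]; exact mul_nonpos_of_nonpos_of_nonneg (not_lt.mp hc) (nn j t)))
    have : s r = 0 := by omega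
    have := ss r
    simp_all
  · intro i j hi hj a b
    by_contra hc
    have hij : i ≠ j := by rintro rfl; omega
    have := same _ _ (h4 i j hij hi hj (fun t => by
      rw [prod, b]; have := nn j t; rw [b] at this
      apply mul_nonneg _ this; omega))
    omega

end Helpers

/-- Corollary `cor-signs-por`. -/
theorem signs_por {n m : ℕ}
    (B : Matrix (Fin n) (Fin n) ℤ) (C : Matrix (Fin n) (Fin m) ℤ)
    (hskew : ∀ i j, B j i = -B i j)
    (v : Fin n)
    (hfork : QFork (mutPair (B, C) v).1 v)
    (hbase : FourConds (mutPair (B, C) v).1 (mutPair (B, C) v).2 v)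
    (w : List (Fin n)) (hw : w ≠ []) (hhead : w.head hw = v)
    (hreduced : List.Chain' (· ≠ ·) w) :
    ∀ i, i ≠ w.getLast hw →
      (∀ t, 0 ≤ (mutSeqPair (B, C) w).1 i (w.getLast hw) *
        (mutSeqPair (B, C) w).2 (w.getLast hw) t) →
      OppSignQ (mutSeqPair (B, C) w).2 i (w.getLast hw) ∧
      ∀ t, |(mutSeqPair (B, C) w).2 (w.getLast hw) t| ≤
        |(mutSeqPair (B, C) w).2 i t| := by
  cases w with
  | nil => exact absurd rfl hw
  | cons x u =>
    simp only [List.head_cons] at hhead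
    subst hhead
    have hf := wfork_of_fork (mutB_skew B x hskew) hfork
    obtain ⟨s, hs⟩ := sinv_of_four hf hbase
    obtain ⟨hF, s', hS⟩ := inv_fold u x (mutPair (B, C) x) s hf hs hreduced
    have hfold : mutSeqPair (B, C) (x :: u) = u.foldl mutPair (mutPair (B, C) x) := rfl
    rw [hfold]
    generalize u.foldl mutPair (mutPair (B, C) x) = P at hF hS ⊢
    generalize (x :: u).getLast hw = r at hF hS ⊢
    intro i hi hpos
    have e := hF.skew i r
    have col : ∀ j, (s' j = 1 → QGreen P.2 j) ∧ (s' j = -1 → QRed P.2 j) := by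
      intro j
      obtain ⟨t, ht⟩ := hS.nz j
      have hne : P.2 j ≠ 0 := fun h0 => ht (congrFun h0 t)
      refine ⟨fun h => ⟨fun t => ?_, hne⟩, fun h => ⟨fun t => ?_, hne⟩⟩ <;>
        have := hS.nn j t <;> rw [h] at this <;> omega
    have hpr : 0 < P.1 i r * s' r := by
      obtain ⟨t, ht⟩ := hS.nz r
      have h1 := hpos t
      have h2 := hS.nn r t
      rcases hF.pos hi with ⟨a, _⟩ | ⟨_, a⟩ <;> rcases hS.pm r with b | b <;>
        rw [b] at h2 ⊢
      · omega
      · exfalso; have : P.2 r t < 0 := by omega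
        nlinarith
      · exfalso; have : 0 < P.2 r t := by omega
        nlinarith
      · omega
    have hopp : s' i = - s' r := by
      by_contra hc
      have hse : s' i = s' r := by
        rcases hS.pm i with a | a <;> rcases hS.pm r with b | b <;> omega
      have := hS.same i hi hse
      rw [hse, e] at this
      linarith
    have hbig := hS.big i hi hopp (by rw [hopp, e]; linarith)
    have hab : ∀ j t, |P.2 j t| = s' j * P.2 j t := by
      intro j t
      have := hS.nn j t
      rcases hS.pm j with a | a <;> rw [a] at this ⊢
      · rw [abs_of_nonneg] <;> omega
      · rw [abs_of_nonpos] <;> omega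
    refine ⟨?_, fun t => ?_⟩
    · rcases hS.pm r with b | b
      · exact Or.inr ⟨(col i).2 (by omega), (col r).1 b⟩
      · exact Or.inl ⟨(col i).1 (by omega), (col r).2 b⟩
    · rw [hab, hab]; exact hbig t
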